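/- Main approximation theorem: Let (I,J,E,λ,μ) be a bipartite instance with λ_j = λ > 0 for every j ∈ J, and let κ := max_{i ∈ I} max_{j ∼ i, j' ∼ i} μ_{ij}/μ_{ij'} ≥ 1. Assume η_s* < 1 and let x_s* be a feasible solution with max_{i ∈ I} ρ_i(x_s*) = η_s* and ρ_i(x_s*) < 1 for every i. Then max_{j ∈ J} w̄_j(x_s*) ≤ κ³ · (1 + (1 − 1/κ) · η_s*/(1 − η_s*)) · η_t*. -/

import Mathlib

open Finset

/-- The workload of worker `i` under allocation `x`:
`ρ_i(x) = ∑_{ℓ ∼ i} x_{iℓ} λ_ℓ / μ_{iℓ}`. -/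
noncomputable def rho {I J : Type*} [Fintype J] (E : I → J → Prop)
    [∀ i j, Decidable (E i j)] (lam : J → ℝ) (mu : I → J → ℝ)
    (x : I → J → ℝ) (i : I) : ℝ :=
  ∑ l ∈ univ.filter (fun l => E i l), x i l * lam l / mu i l

/-- Feasibility of an allocation `x` for the instance `(I, J, E, λ, μ)`. -/
def Feasible {I J : Type*} [Fintype I] [Fintype J] (E : I → J → Prop)
    [∀ i j, Decidable (E i j)] (lam : J → ℝ) (mu : I → J → ℝ)
    (x : I → J → ℝ) : Prop :=
  (∀ i j, ¬ E i j → x i j = 0) ∧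
  (∀ i j, 0 ≤ x i j ∧ x i j ≤ 1) ∧
  (∀ j, ∑ i ∈ univ.filter (fun i => E i j), x i j = 1) ∧
  (∀ i, rho E lam mu x i ≤ 1)

/-- Strict feasibility: feasibility plus `ρ_i(x) < 1` for every worker. -/
def StrictFeasible {I J : Type*} [Fintype I] [Fintype J] (E : I → J → Prop)
    [∀ i j, Decidable (E i j)] (lam : J → ℝ) (mu : I → J → ℝ)
    (x : I → J → ℝ) : Prop :=
  Feasible E lam mu x ∧ ∀ i, rho E lam mu x i < 1

/-- Expected relative waiting time of task type `j` under allocation `x`. -/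
noncomputable def wbar {I J : Type*} [Fintype I] [Fintype J] (E : I → J → Prop)
    [∀ i j, Decidable (E i j)] (lam : J → ℝ) (mu : I → J → ℝ)
    (x : I → J → ℝ) (j : J) : ℝ :=
  ∑ i ∈ univ.filter (fun i => E i j),
    x i j * mu i j *
      ((∑ l ∈ univ.filter (fun l => E i l), x i l * lam l / (mu i l) ^ 2) /
        (1 - ∑ l ∈ univ.filter (fun l => E i l), x i l * lam l / mu i l))

/-- Optimal value `η_s*` of Program P_B: the infimum over feasible `x`
of the maximum workload. -/
noncomputable def etaS {I J : Type*} [Fintype I] [Fintype J] (E : I → J → Prop)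
    [∀ i j, Decidable (E i j)] (lam : J → ℝ) (mu : I → J → ℝ) : ℝ :=
  sInf ((fun x => ⨆ i, rho E lam mu x i) '' {x | Feasible E lam mu x})

/-- Optimal value `η_t*` of Program P_A: the infimum over strictly feasible `x`
of the maximum relative waiting time. -/
noncomputable def etaT {I J : Type*} [Fintype I] [Fintype J] (E : I → J → Prop)
    [∀ i j, Decidable (E i j)] (lam : J → ℝ) (mu : I → J → ℝ) : ℝ :=
  sInf ((fun x => ⨆ j, wbar E lam mu x j) '' {x | StrictFeasible E lam mu x})

/-- Optimal value `η̄_t*` of Program P̄_A (the simplified program in the uniform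
case): the infimum over strictly feasible `x` of
`max_j ((∑_{i ∼ j} x_{ij}/(1 − ρ_i(x))) − 1)`. -/
noncomputable def etaTbar {I J : Type*} [Fintype I] [Fintype J] (E : I → J → Prop)
    [∀ i j, Decidable (E i j)] (lam : J → ℝ) (mu : I → J → ℝ) : ℝ :=
  sInf ((fun x => ⨆ j,
    (∑ i ∈ univ.filter (fun i => E i j), x i j / (1 - rho E lam mu x i)) - 1) ''
      {x | StrictFeasible E lam mu x})

lemma aux_first_order (A B : ℝ) (hB : 0 ≤ B)
    (h : ∀ t : ℝ, 0 < t → t ≤ 1 → 0 ≤ 2 * t * A + t ^ 2 * B) : 0 ≤ A := by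
  by_contra hA
  push Not at hA
  have hB1 : 0 < B + 1 := by linarith
  have hq : 0 < -A / (B + 1) := div_pos (by linarith) hB1
  have ht0 : 0 < min 1 (-A / (B + 1)) := lt_min one_pos hq
  have h1 := h _ ht0 (min_le_left _ _)
  set t := min 1 (-A / (B + 1)) with ht
  have h2 : t * (B + 1) ≤ -A := by
    have : t ≤ -A / (B + 1) := min_le_right _ _
    rwa [le_div_iff₀ hB1] at this
  have h3 : 0 ≤ t * (2 * A + t * B) := by nlinarith
  have h4 : 0 ≤ 2 * A + t * B := nonneg_of_mul_nonneg_right h3 ht0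
  nlinarith

lemma exists_balanced {I J : Type*} [Fintype I] [Fintype J]
    (E : I → J → Prop) (hEj : ∀ j, ∃ i, E i j) (m : I → ℝ) (hm : ∀ i, 0 < m i) :
    ∃ z : I → J → ℝ, (∀ i j, ¬ E i j → z i j = 0) ∧ (∀ i j, 0 ≤ z i j) ∧
      (∀ j, ∑ i, z i j = 1) ∧
      ∀ i' j, E i' j → ∑ i, z i j * ((∑ l, z i l) / m i) ≤ (∑ l, z i' l) / m i' := by
  classical
  let K : Set (I → J → ℝ) := {x | (∀ i j, ¬ E i j → x i j = 0) ∧ (∀ i j, 0 ≤ x i j) ∧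
      (∀ j, ∑ i, x i j = 1)}
  have hcl : IsClosed K := by
    have : K = (⋂ i, ⋂ j, ⋂ (_ : ¬ E i j), {x | x i j = 0}) ∩
        ((⋂ i, ⋂ j, {x | 0 ≤ x i j}) ∩ ⋂ j, {x | ∑ i, x i j = 1}) := by
      ext x; simp [K]
    rw [this]
    refine IsClosed.inter ?_ (IsClosed.inter ?_ ?_)
    · refine isClosed_iInter fun i => isClosed_iInter fun j => isClosed_iInter fun _ => ?_
      exact isClosed_eq (by fun_prop) (by fun_prop)
    · refine isClosed_iInter fun i => isClosed_iInter fun j => ?_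
      exact isClosed_le (by fun_prop) (by fun_prop)
    · refine isClosed_iInter fun j => ?_
      exact isClosed_eq (by fun_prop) (by fun_prop)
  have hK : IsCompact K := by
    refine (isCompact_Icc (a := (0 : I → J → ℝ)) (b := 1)).of_isClosed_subset hcl ?_
    rintro x ⟨_, h2, h3⟩
    refine ⟨fun i j => h2 i j, fun i j => ?_⟩
    have := Finset.single_le_sum (f := fun i => x i j) (fun i _ => h2 i j) (Finset.mem_univ i)
    simp only [h3 j] at this
    exact this
  have hne : K.Nonempty := by
    choose g hg using hEj
    refine ⟨fun i j => if i = g j then 1 else 0, ?_, ?_, ?_⟩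
    · intro i j h
      have : i ≠ g j := by rintro rfl; exact h (hg j)
      simp [this]
    · intro i j; dsimp only; split_ifs <;> norm_num
    · intro j; simp
  obtain ⟨z, hz, hmin⟩ := hK.exists_isMinOn hne
    (f := fun x => ∑ i, (∑ l, x i l) ^ 2 / m i) (by fun_prop)
  obtain ⟨z1, z2, z3⟩ := hz
  refine ⟨z, z1, z2, z3, ?_⟩
  intro i' j hE
  let D : I → ℝ := fun i => (if i = i' then 1 else 0) - z i j
  have key : 0 ≤ ∑ i, D i * ((∑ l, z i l) / m i) := by
    refine aux_first_order _ (∑ i, D i ^ 2 / m i)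
      (Finset.sum_nonneg fun i _ => div_nonneg (sq_nonneg _) (hm i).le) ?_
    intro t ht0 ht1
    let x : I → J → ℝ := fun i l => z i l + if l = j then t * D i else 0
    have hx : x ∈ K := by
      refine ⟨?_, ?_, ?_⟩
      · intro i l h
        simp only [x, z1 i l h, D]
        by_cases hl : l = j
        · subst hl
          have : i ≠ i' := by rintro rfl; exact h hE
          simp [this, z1 i l h]
        · simp [hl]
      · intro i l
        simp only [x, D]
        have := z2 i l
        by_cases hl : l = j
        · subst hl
          simp only [if_true]
          split_ifs <;> nlinarith
        · simp [hl, this]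
      · intro l
        simp only [x, D, Finset.sum_add_distrib, z3]
        by_cases hl : l = j
        · simp [hl, ← Finset.mul_sum, Finset.sum_sub_distrib, z3]
        · simp [hl]
    have h := hmin hx
    simp only [Set.mem_ofPred_eq] at h
    have hY : ∀ i, ∑ l, x i l = ∑ l, z i l + t * D i := by
      intro i; simp [x, Finset.sum_add_distrib]
    simp only [hY] at h
    rw [← sub_nonneg, ← Finset.sum_sub_distrib] at h
    rw [Finset.mul_sum, Finset.mul_sum, ← Finset.sum_add_distrib]
    refine h.trans_eq (Finset.sum_congr rfl fun i _ => ?_)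
    ring
  simp only [D, sub_mul, Finset.sum_sub_distrib] at key
  simp at key
  linarith

lemma tangent_aux (u v d : ℝ) (hu : 0 ≤ u) (huv : u ≤ v) (hv : v < 1) (hd : d < 1) :
    u * (d / (1 - d)) + d / (1 - d) ^ 2 * (u - d) ≤ u * (v / (1 - v)) := by
  have h1 : 0 < 1 - d := by linarith
  have h2 : 0 < 1 - u := by linarith
  have h3 : 0 < 1 - v := by linarith
  have h4 : u / (1 - u) ≤ v / (1 - v) := by
    rw [div_le_div_iff₀ h2 h3]; nlinarith
  have h5 : u * (u / (1 - u)) ≤ u * (v / (1 - v)) := mul_le_mul_of_nonneg_left h4 hu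
  have h6 : u * (u / (1 - u)) - (u * (d / (1 - d)) + d / (1 - d) ^ 2 * (u - d))
      = (u - d) ^ 2 / ((1 - d) ^ 2 * (1 - u)) := by
    field_simp; ring
  have h7 : 0 ≤ (u - d) ^ 2 / ((1 - d) ^ 2 * (1 - u)) := by positivity
  linarith

/-- Lower bound: balanced `z` with max load `c`, any `d ≤ c`, `d < 1`. -/
lemma lower_bound {I J : Type*} [Fintype I] [Fintype J] [Nonempty I] [Nonempty J]
    (E : I → J → Prop) (m : I → ℝ) (hm : ∀ i, 0 < m i)
    (lam0 : ℝ) (hl : 0 < lam0) (z : I → J → ℝ)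
    (z1 : ∀ i j, ¬ E i j → z i j = 0) (z2 : ∀ i j, 0 ≤ z i j) (z3 : ∀ j, ∑ i, z i j = 1)
    (z4 : ∀ i' j, E i' j → ∑ i, z i j * ((∑ l, z i l) / m i) ≤ (∑ l, z i' l) / m i')
    (d : ℝ) (hd0 : 0 ≤ d) (hd1 : d < 1) (hd : ∃ i, d ≤ lam0 * ((∑ l, z i l) / m i))
    (x : I → J → ℝ) (x1 : ∀ i j, ¬ E i j → x i j = 0) (x2 : ∀ i j, 0 ≤ x i j)
    (x3 : ∀ j, ∑ i, x i j = 1) (r : I → ℝ) (hr1 : ∀ i, r i < 1)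
    (hr : ∀ i, lam0 * (∑ l, x i l) / m i ≤ r i) :
    ∃ j, d / (1 - d) ≤ ∑ i, x i j * (r i / (1 - r i)) := by
  classical
  set a : I → ℝ := fun i => (∑ l, z i l) / m i with ha
  obtain ⟨i0, hi0⟩ := Finite.exists_max a
  set c := a i0 with hc
  have hdc : d ≤ lam0 * c := by
    obtain ⟨i, hi⟩ := hd
    exact hi.trans (mul_le_mul_of_nonneg_left (hi0 i) hl.le)
  have hYa : ∀ i, ∑ l, z i l = a i * m i := fun i => by
    simp only [ha]; rw [div_mul_cancel₀ _ (hm i).ne']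
  have hc0 : 0 < c := by
    by_contra hcn
    push Not at hcn
    have h1 : ∑ i, ∑ l, z i l ≤ 0 := Finset.sum_nonpos fun i _ => by
      rw [hYa]; exact mul_nonpos_of_nonpos_of_nonneg ((hi0 i).trans hcn) (hm i).le
    rw [Finset.sum_comm] at h1
    simp only [z3] at h1
    simp at h1
  let S : Finset I := Finset.univ.filter (fun i => a i = c)
  let T : Finset J := Finset.univ.filter (fun j => ∀ i, E i j → a i = c)
  -- if i in S and z i j > 0 then j in T
  have hST : ∀ i ∈ S, ∀ j, j ∉ T → z i j = 0 := by
    intro i hi j hj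
    simp only [S, T, Finset.mem_filter, Finset.mem_univ, true_and] at hi hj
    push Not at hj
    obtain ⟨k, hk, hkc⟩ := hj
    have hklt : a k < c := lt_of_le_of_ne (hi0 k) hkc
    by_contra hne
    -- minimum neighbour
    obtain ⟨k', hk', hmin⟩ := Finset.exists_min_image (Finset.univ.filter (fun i => E i j)) a
      ⟨k, by simp [hk]⟩
    simp only [Finset.mem_filter, Finset.mem_univ, true_and] at hk' hmin
    have h4 := z4 k' j hk'
    have h5 : ∑ i, z i j * (a i - a k') ≤ 0 := by
      simp only [mul_sub, Finset.sum_sub_distrib, ← Finset.sum_mul, z3]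
      change ∑ i, z i j * a i ≤ a k' at h4
      linarith
    have hnn : ∀ i ∈ Finset.univ, 0 ≤ z i j * (a i - a k') := by
      intro i _
      by_cases hE : E i j
      · exact mul_nonneg (z2 i j) (sub_nonneg.2 (hmin i hE))
      · simp [z1 i j hE]
    have h6 := Finset.single_le_sum hnn (Finset.mem_univ i)
    have h7 : 0 < z i j := lt_of_le_of_ne (z2 i j) (Ne.symm hne)
    have h8 := hmin k hk
    have h9 : 0 < z i j * (a i - a k') := mul_pos h7 (by rw [hi]; linarith)
    linarith
  have hcol : ∀ (y : I → J → ℝ), (∀ i j, ¬ E i j → y i j = 0) → (∀ j, ∑ i, y i j = 1) →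
      ∑ i ∈ S, ∑ j ∈ T, y i j = T.card := by
    intro y y1 y3
    rw [Finset.sum_comm]
    have : ∀ j ∈ T, ∑ i ∈ S, y i j = 1 := by
      intro j hj
      rw [← y3 j]
      refine Finset.sum_subset (Finset.subset_univ _) fun i _ hi => y1 i j fun hE => hi ?_
      simp only [S, T, Finset.mem_filter, Finset.mem_univ, true_and] at hj ⊢
      exact hj i hE
    rw [Finset.sum_congr rfl this]; simp
  have hTc : (T.card : ℝ) = c * ∑ i ∈ S, m i := by
    rw [← hcol z z1 z3, Finset.mul_sum]
    refine Finset.sum_congr rfl fun i hi => ?_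
    have h1 : ∑ j ∈ T, z i j = ∑ j, z i j :=
      Finset.sum_subset (Finset.subset_univ _) fun j _ hj => hST i hi j hj
    rw [h1, hYa]
    simp only [S, Finset.mem_filter, Finset.mem_univ, true_and] at hi
    rw [hi]
  have hSm : 0 < ∑ i ∈ S, m i :=
    Finset.sum_pos (fun i _ => hm i) ⟨i0, by simp [S, hc]⟩
  have hTpos : (0:ℝ) < T.card := by rw [hTc]; positivity
  have hTne : T.Nonempty := Finset.card_pos.1 (by exact_mod_cast hTpos)
  have h1d : 0 < 1 - d := by linarith
  by_contra hcon
  push Not at hcon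
  have hlt : ∑ j ∈ T, ∑ i, x i j * (r i / (1 - r i)) < ∑ j ∈ T, d / (1 - d) :=
    Finset.sum_lt_sum_of_nonempty hTne fun j _ => hcon j
  have hr0 : ∀ i, 0 ≤ r i := fun i => le_trans
    (div_nonneg (mul_nonneg hl.le (Finset.sum_nonneg fun l _ => x2 i l)) (hm i).le) (hr i)
  -- lower bound
  have hge : ∑ i ∈ S, (∑ j ∈ T, x i j) * (r i / (1 - r i)) ≤
      ∑ j ∈ T, ∑ i, x i j * (r i / (1 - r i)) := by
    simp only [Finset.sum_mul]
    rw [Finset.sum_comm]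
    refine Finset.sum_le_sum fun j _ => ?_
    refine Finset.sum_le_sum_of_subset_of_nonneg (Finset.subset_univ _) fun i _ _ => ?_
    exact mul_nonneg (x2 i j) (div_nonneg (hr0 i) (by linarith [hr1 i]))
  have htan : ∀ i ∈ S, (lam0 * ∑ j ∈ T, x i j) * (d / (1 - d)) +
      d / (1 - d) ^ 2 * (lam0 * ∑ j ∈ T, x i j - d * m i) ≤
      lam0 * ((∑ j ∈ T, x i j) * (r i / (1 - r i))) := by
    intro i _
    have hmi := hm i
    have hy0 : 0 ≤ ∑ j ∈ T, x i j := Finset.sum_nonneg fun j _ => x2 i j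
    have hy1 : ∑ j ∈ T, x i j ≤ ∑ j, x i j :=
      Finset.sum_le_sum_of_subset_of_nonneg (Finset.subset_univ _) fun j _ _ => x2 i j
    have hu : lam0 * (∑ j ∈ T, x i j) / m i ≤ r i := by
      refine le_trans ?_ (hr i)
      gcongr
    have := tangent_aux (lam0 * (∑ j ∈ T, x i j) / m i) (r i) d (by positivity) hu (hr1 i) hd1
    have h2 := mul_le_mul_of_nonneg_left this hmi.le
    have e : lam0 * (∑ j ∈ T, x i j) = m i * (lam0 * (∑ j ∈ T, x i j) / m i) := by
      field_simp
    rw [← mul_assoc lam0, e]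
    linarith
  have hsum := Finset.sum_le_sum htan
  rw [Finset.sum_add_distrib, ← Finset.sum_mul, ← Finset.mul_sum, ← Finset.mul_sum,
    Finset.sum_sub_distrib, ← Finset.mul_sum, ← Finset.mul_sum, ← Finset.mul_sum,
    hcol x x1 x3] at hsum
  have hk : 0 ≤ d / (1 - d) ^ 2 * (lam0 * (T.card : ℝ) - d * ∑ i ∈ S, m i) := by
    refine mul_nonneg (by positivity) ?_
    rw [hTc]
    nlinarith
  simp only [Finset.sum_const, nsmul_eq_mul] at hlt
  have hfin := mul_lt_mul_of_pos_left (hge.trans_lt hlt) hl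
  linarith

lemma fsum_eq {K : Type*} [Fintype K] (p : K → Prop) [DecidablePred p] (f : K → ℝ)
    (h : ∀ k, ¬ p k → f k = 0) : ∑ k ∈ univ.filter p, f k = ∑ k, f k :=
  Finset.sum_subset (Finset.subset_univ _) fun k _ hk => h k (by simpa using hk)

/-- **Main approximation theorem.** With uniform arrival rates and
`κ = max_i max_{j ∼ i, j' ∼ i} μ_{ij}/μ_{ij'} ≥ 1`: if `η_s* < 1` and `x_s*` is
a feasible solution attaining `η_s*` with all workloads below 1, then
`max_j w̄_j(x_s*) ≤ κ³ (1 + (1 − 1/κ) η_s*/(1 − η_s*)) η_t*`. -/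
theorem main_approximation
    {I J : Type*} [Fintype I] [Fintype J] [Nonempty I] [Nonempty J]
    (E : I → J → Prop) [∀ i j, Decidable (E i j)]
    (lam : J → ℝ) (mu : I → J → ℝ)
    (hlam : ∀ j, 0 < lam j) (hmu : ∀ i j, E i j → 0 < mu i j)
    (hEj : ∀ j, ∃ i, E i j) (hEi : ∀ i, ∃ j, E i j)
    (lam0 : ℝ) (hlam0 : 0 < lam0) (hlamu : ∀ j, lam j = lam0)
    (kappa : ℝ)
    (hkappa : kappa = ⨆ p : {p : I × J × J // E p.1 p.2.1 ∧ E p.1 p.2.2},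
        mu p.1.1 p.1.2.1 / mu p.1.1 p.1.2.2)
    (hkappa1 : 1 ≤ kappa)
    (hetaS : etaS E lam mu < 1)
    (xs : I → J → ℝ) (hxs : Feasible E lam mu xs)
    (hopt : (⨆ i, rho E lam mu xs i) = etaS E lam mu)
    (hlt : ∀ i, rho E lam mu xs i < 1) :
    (⨆ j, wbar E lam mu xs j) ≤
      kappa ^ 3 * (1 + (1 - 1 / kappa) * (etaS E lam mu / (1 - etaS E lam mu))) *
        etaT E lam mu := by
  have hkp : 0 < kappa := by linarith
  have hkap : ∀ i j j', E i j → E i j' → mu i j ≤ kappa * mu i j' := by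
    intro i j j' h h'
    have := le_ciSup (f := fun p : {p : I × J × J // E p.1 p.2.1 ∧ E p.1 p.2.2} =>
      mu p.1.1 p.1.2.1 / mu p.1.1 p.1.2.2) (Set.finite_range _).bddAbove ⟨(i, j, j'), h, h'⟩
    rw [← hkappa] at this
    exact (div_le_iff₀ (hmu i j' h')).1 this
  have hm : ∀ i, ∃ m, 0 < m ∧ (∀ j, E i j → mu i j ≤ m ∧ m ≤ kappa * mu i j) := by
    intro i
    obtain ⟨j0, hj0⟩ := hEi i
    obtain ⟨j, hj, hmax⟩ := Finset.exists_max_image (univ.filter (fun j => E i j)) (mu i)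
      ⟨j0, by simp [hj0]⟩
    simp only [mem_filter, mem_univ, true_and] at hj hmax
    exact ⟨mu i j, hmu i j hj, fun l hl => ⟨hmax l hl, hkap i j l hj hl⟩⟩
  choose m hm0 hm1 using hm
  set h := etaS E lam mu with hh
  have hrho0 : ∀ x : I → J → ℝ, (∀ i j, 0 ≤ x i j) → ∀ i, 0 ≤ rho E lam mu x i := by
    intro x hx i
    refine Finset.sum_nonneg fun l hl => ?_
    simp only [mem_filter, mem_univ, true_and] at hl
    exact div_nonneg (mul_nonneg (hx i l) (hlam l).le) (hmu i l hl).le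
  have hle : ∀ x : I → J → ℝ, ∀ i, rho E lam mu x i ≤ ⨆ i, rho E lam mu x i :=
    fun x i => le_ciSup (Set.finite_range _).bddAbove i
  have hh0 : 0 ≤ h := by
    obtain ⟨i⟩ := ‹Nonempty I›
    rw [← hopt]
    exact (hrho0 xs (fun i j => (hxs.2.1 i j).1) i).trans (hle xs i)
  have h1h : 0 < 1 - h := by linarith
  set d := h / kappa with hd
  have hd0 : 0 ≤ d := by positivity
  have hdh : d ≤ h := div_le_self hh0 hkappa1
  have h1d : 0 < 1 - d := by linarith
  obtain ⟨z, z1, z2, z3, z4⟩ := exists_balanced E hEj m hm0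
  -- rho bounds
  have hrhoU : ∀ x : I → J → ℝ, (∀ i j, ¬ E i j → x i j = 0) → (∀ i j, 0 ≤ x i j) → ∀ i,
      rho E lam mu x i ≤ kappa * (lam0 * ((∑ l, x i l) / m i)) := by
    intro x x1 x2 i
    have e : kappa * (lam0 * ((∑ l, x i l) / m i)) =
        ∑ l ∈ univ.filter (fun l => E i l), x i l * (kappa * lam0 / m i) := by
      rw [← Finset.sum_mul, fsum_eq _ _ (x1 i)]; ring
    rw [e]
    refine Finset.sum_le_sum fun l hl => ?_
    simp only [mem_filter, mem_univ, true_and] at hl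
    rw [hlamu, mul_div_assoc]
    refine mul_le_mul_of_nonneg_left ?_ (x2 i l)
    rw [div_le_div_iff₀ (hmu i l hl) (hm0 i)]
    have := (hm1 i l hl).2
    nlinarith
  have hrhoL : ∀ x : I → J → ℝ, (∀ i j, ¬ E i j → x i j = 0) → (∀ i j, 0 ≤ x i j) → ∀ i,
      lam0 * (∑ l, x i l) / m i ≤ rho E lam mu x i := by
    intro x x1 x2 i
    have e : lam0 * (∑ l, x i l) / m i =
        ∑ l ∈ univ.filter (fun l => E i l), x i l * (lam0 / m i) := by
      rw [← Finset.sum_mul, fsum_eq _ _ (x1 i)]; ring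
    rw [e]
    refine Finset.sum_le_sum fun l hl => ?_
    simp only [mem_filter, mem_univ, true_and] at hl
    rw [hlamu, mul_div_assoc]
    refine mul_le_mul_of_nonneg_left ?_ (x2 i l)
    exact div_le_div_of_nonneg_left hlam0.le (hmu i l hl) (hm1 i l hl).1
  have hdz : ∃ i, d ≤ lam0 * ((∑ l, z i l) / m i) := by
    by_contra hcon
    push Not at hcon
    have hlt' : ∀ i, rho E lam mu z i < h := by
      intro i
      refine (hrhoU z z1 z2 i).trans_lt ?_
      have := mul_lt_mul_of_pos_left (hcon i) hkp
      rwa [hd, mul_div_cancel₀ _ hkp.ne'] at this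
    have hzf : Feasible E lam mu z := by
      refine ⟨z1, fun i j => ⟨z2 i j, ?_⟩, fun j => ?_, fun i => by linarith [hlt' i]⟩
      · rw [← z3 j]
        exact Finset.single_le_sum (f := fun i => z i j) (fun i _ => z2 i j) (Finset.mem_univ i)
      · rw [fsum_eq _ _ (fun i hi => z1 i j hi), z3]
    have h1 : h ≤ ⨆ i, rho E lam mu z i := by
      refine csInf_le ⟨0, ?_⟩ ⟨z, hzf, rfl⟩
      rintro _ ⟨x, hx, rfl⟩
      obtain ⟨i⟩ := ‹Nonempty I›
      exact (hrho0 x (fun i j => (hx.2.1 i j).1) i).trans (hle x i)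
    obtain ⟨i, hi⟩ := exists_eq_ciSup_of_finite (f := fun i => rho E lam mu z i)
    rw [← hi] at h1
    exact absurd (hlt' i) (not_lt.2 h1)
  -- wbar bounds
  have hin : ∀ x : I → J → ℝ, (∀ i j, 0 ≤ x i j) → ∀ i j, E i j →
      rho E lam mu x i / kappa ≤
        mu i j * ∑ l ∈ univ.filter (fun l => E i l), x i l * lam l / (mu i l) ^ 2 ∧
      mu i j * ∑ l ∈ univ.filter (fun l => E i l), x i l * lam l / (mu i l) ^ 2 ≤
        kappa * rho E lam mu x i := by
    intro x x2 i j hE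
    unfold rho
    rw [Finset.mul_sum, Finset.mul_sum, Finset.sum_div]
    have hj := hmu i j hE
    constructor
    · refine Finset.sum_le_sum fun l hl => ?_
      simp only [mem_filter, mem_univ, true_and] at hl
      have hl0 := hmu i l hl
      have hk := hkap i l j hl hE
      have hx : 0 ≤ x i l * lam l := mul_nonneg (x2 i l) (hlam l).le
      have e1 : x i l * lam l / mu i l / kappa = x i l * lam l * (1 / (mu i l * kappa)) := by
        field_simp
      have e2 : mu i j * (x i l * lam l / mu i l ^ 2) = x i l * lam l * (mu i j / mu i l ^ 2) := by
        field_simp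
      rw [e1, e2]
      refine mul_le_mul_of_nonneg_left ?_ hx
      rw [div_le_div_iff₀ (by positivity) (by positivity)]
      nlinarith
    · refine Finset.sum_le_sum fun l hl => ?_
      simp only [mem_filter, mem_univ, true_and] at hl
      have hl0 := hmu i l hl
      have hk := hkap i j l hE hl
      have hx : 0 ≤ x i l * lam l := mul_nonneg (x2 i l) (hlam l).le
      have e1 : kappa * (x i l * lam l / mu i l) = x i l * lam l * (kappa / mu i l) := by
        field_simp
      have e2 : mu i j * (x i l * lam l / mu i l ^ 2) = x i l * lam l * (mu i j / mu i l ^ 2) := by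
        field_simp
      rw [e1, e2]
      refine mul_le_mul_of_nonneg_left ?_ hx
      rw [div_le_div_iff₀ (by positivity) (by positivity)]
      nlinarith
  have hup : (⨆ j, wbar E lam mu xs j) ≤ kappa * (h / (1 - h)) := by
    refine ciSup_le fun j => ?_
    have e : kappa * (h / (1 - h)) =
        ∑ i ∈ univ.filter (fun i => E i j), xs i j * (kappa * (h / (1 - h))) := by
      rw [← Finset.sum_mul, hxs.2.2.1 j, one_mul]
    rw [e]
    refine Finset.sum_le_sum fun i hi => ?_
    simp only [mem_filter, mem_univ, true_and] at hi
    rw [mul_assoc]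
    refine mul_le_mul_of_nonneg_left ?_ (hxs.2.1 i j).1
    rw [← mul_div_assoc, ← mul_div_assoc]
    have hri : rho E lam mu xs i ≤ h := by rw [← hopt]; exact hle xs i
    have := (hin xs (fun i j => (hxs.2.1 i j).1) i j hi).2
    refine div_le_div₀ (by positivity) (this.trans ?_) h1h ?_
    · exact mul_le_mul_of_nonneg_left hri hkp.le
    · change 1 - h ≤ 1 - rho E lam mu xs i
      linarith
  have hlow : (1 / kappa) * (d / (1 - d)) ≤ etaT E lam mu := by
    refine le_csInf ⟨_, xs, ⟨hxs, hlt⟩, rfl⟩ ?_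
    rintro _ ⟨x, ⟨hx, hxlt⟩, rfl⟩
    have x2 : ∀ i j, 0 ≤ x i j := fun i j => (hx.2.1 i j).1
    obtain ⟨j, hj⟩ := lower_bound E m hm0 lam0 hlam0 z z1 z2 z3 z4 d hd0 (by linarith) hdz x hx.1
      x2 (fun j => by rw [← hx.2.2.1 j, fsum_eq _ _ (fun i hi => hx.1 i j hi)])
      (rho E lam mu x) hxlt (hrhoL x hx.1 x2)
    refine le_trans ?_ (le_ciSup (f := fun j => wbar E lam mu x j)
      (Set.finite_range _).bddAbove j)
    refine (mul_le_mul_of_nonneg_left hj (by positivity)).trans ?_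
    rw [← fsum_eq (fun i => E i j) _ (fun i hi => by rw [hx.1 i j hi, zero_mul]), Finset.mul_sum]
    refine Finset.sum_le_sum fun i hi => ?_
    simp only [mem_filter, mem_univ, true_and] at hi
    have h1 := (hin x x2 i j hi).1
    have h2 : 0 < 1 - rho E lam mu x i := by linarith [hxlt i]
    have e : 1 / kappa * (x i j * (rho E lam mu x i / (1 - rho E lam mu x i))) =
        x i j * (rho E lam mu x i / kappa / (1 - rho E lam mu x i)) := by
      field_simp
    rw [e, mul_assoc (x i j)]
    refine mul_le_mul_of_nonneg_left ?_ (x2 i j)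
    rw [← mul_div_assoc]
    exact div_le_div_of_nonneg_right h1 h2.le
  have hC : 0 ≤ kappa ^ 3 * (1 + (1 - 1 / kappa) * (h / (1 - h))) := by
    have : 0 ≤ 1 - 1 / kappa := by
      rw [sub_nonneg, div_le_one hkp]; exact hkappa1
    positivity
  refine hup.trans (le_trans (le_of_eq ?_) (mul_le_mul_of_nonneg_left hlow hC))
  have hkh : kappa - h ≠ 0 := by linarith
  have e1 : d / (1 - d) = h / (kappa - h) := by
    have : 1 - d = (kappa - h) / kappa := by rw [hd]; field_simp
    rw [this, hd]; field_simp
  rw [e1]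
  field_simp
  ring
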